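/- Let W be a discrete memoryless channel with C(W) > 0, fix δ > 0 and ε ∈ (0,1), and let S₃(δ) = { P ∈ P(X) : min_{P*: I(P*;W)=C(W)} ‖P − P*‖₂ > δ }. Consider any sequence of constant composition blocklength-N codes (f_N, φ_N) of rate R_N = C(W) + √(V_ε(W)/N)·Φ^{−1}(ε) (i.e., with ⌈e^{N R_N}⌉ messages) whose common composition Q_N lies in S₃(δ). Then there exists N₀(W,ε,δ) ∈ ℤ⁺ such that for all N ≥ N₀(W,ε,δ), the average error probability satisfies P̄_e(f_N, φ_N) > ε. -/

import Mathlib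

open Real Finset

variable {X Y : Type} [Fintype X] [Fintype Y]

/-- A discrete memoryless channel: `W x y` is the probability of output `y` given input `x`. -/
def IsDMC (W : X → Y → ℝ) : Prop :=
  (∀ x y, 0 ≤ W x y) ∧ ∀ x, ∑ y, W x y = 1

/-- A probability distribution on a finite alphabet. -/
def IsProbDist (Q : X → ℝ) : Prop :=
  (∀ x, 0 ≤ Q x) ∧ ∑ x, Q x = 1

/-- Gallager symmetry: the output alphabet can be partitioned into classes such that within
each class every row is a permutation of every other row, and every column is a permutation
of every other column. -/
def GallagerSymmetric (W : X → Y → ℝ) : Prop :=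
  ∃ cls : Y → ℕ,
    (∀ (l : ℕ) (x x' : X),
        ((Finset.univ.filter fun y => cls y = l).val.map fun y => W x y) =
        ((Finset.univ.filter fun y => cls y = l).val.map fun y => W x' y)) ∧
    (∀ y y' : Y, cls y = cls y' →
        (Finset.univ.val.map fun x => W x y) = (Finset.univ.val.map fun x => W x y'))

/-- Singularity: whenever two inputs both give an output positive probability,
they give it the same probability. -/
def Singular (W : X → Y → ℝ) : Prop :=
  ∀ x z y, 0 < W x y * W z y → W x y = W z y

/-- Gallager's function `E_o(ρ, Q)`. -/
noncomputable def Eo (W : X → Y → ℝ) (Q : X → ℝ) (ρ : ℝ) : ℝ :=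
  - Real.log (∑ y, (∑ x, Q x * W x y ^ (1 / (1 + ρ))) ^ (1 + ρ))

/-- Mutual information `I(Q; W)`. -/
noncomputable def mutualInfo (W : X → Y → ℝ) (Q : X → ℝ) : ℝ :=
  ∑ x, ∑ y, Q x * W x y * Real.log (W x y / ∑ z, Q z * W z y)

/-- Channel capacity `C(W)`. -/
noncomputable def capacity (W : X → Y → ℝ) : ℝ :=
  sSup {r | ∃ Q, IsProbDist Q ∧ r = mutualInfo W Q}

/-- The set of values whose supremum is the sphere-packing exponent. -/
def ESPset (W : X → Y → ℝ) (R : ℝ) : Set ℝ :=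
  {e | ∃ Q, IsProbDist Q ∧ ∃ ρ : ℝ, 0 ≤ ρ ∧ e = Eo W Q ρ - ρ * R}

/-- The sphere-packing exponent `E_SP(R) = max_Q sup_{ρ ≥ 0} (E_o(ρ,Q) - ρ R)`. -/
noncomputable def ESP (W : X → Y → ℝ) (R : ℝ) : ℝ := sSup (ESPset W R)

/-- The random coding exponent `E_r(R) = max_Q max_{0 ≤ ρ ≤ 1} (E_o(ρ,Q) - ρ R)`. -/
noncomputable def Er (W : X → Y → ℝ) (R : ℝ) : ℝ :=
  sSup {e | ∃ Q, IsProbDist Q ∧ ∃ ρ : ℝ, 0 ≤ ρ ∧ ρ ≤ 1 ∧ e = Eo W Q ρ - ρ * R}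

/-- `R_∞`: the supremum of rates at which the sphere-packing exponent is infinite
(i.e. the defining supremum is unbounded). -/
noncomputable def Rinf (W : X → Y → ℝ) : ℝ :=
  sSup {R | ¬ BddAbove (ESPset W R)}

/-- The critical rate `R_cr`: the smallest rate above which `E_r = E_SP`. -/
noncomputable def Rcr (W : X → Y → ℝ) : ℝ :=
  sInf {R | ∀ R', R ≤ R' → Er W R' = ESP W R'}

/-- Number of messages of an `(N, R)` code: `⌈e^{NR}⌉`. -/
noncomputable def Mof (N : ℕ) (R : ℝ) : ℕ := ⌈Real.exp (N * R)⌉₊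

/-- Error probability of message `m` for a (non-feedback) block code. -/
noncomputable def msgErrorProb (W : X → Y → ℝ) {N M : ℕ}
    (f : Fin M → Fin N → X) (φ : (Fin N → Y) → Fin M) (m : Fin M) : ℝ :=
  ∑ y ∈ Finset.univ.filter (fun y : Fin N → Y => φ y ≠ m), ∏ n, W (f m n) (y n)

/-- Average error probability of a (non-feedback) block code. -/
noncomputable def avgErrorProb (W : X → Y → ℝ) {N M : ℕ}
    (f : Fin M → Fin N → X) (φ : (Fin N → Y) → Fin M) : ℝ :=
  (M : ℝ)⁻¹ * ∑ m, msgErrorProb W f φ m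

/-- A feedback encoder, given as a function of the whole output word, is causal if the symbol
sent at time `n` depends only on the message and the outputs at times `< n`. -/
def Causal {N M : ℕ} (f : Fin M → (Fin N → Y) → Fin N → X) : Prop :=
  ∀ m y y' n, (∀ k, k < n → y k = y' k) → f m y n = f m y' n

/-- Average error probability of a feedback code. -/
noncomputable def avgErrorProbFb (W : X → Y → ℝ) {N M : ℕ}
    (f : Fin M → (Fin N → Y) → Fin N → X) (φ : (Fin N → Y) → Fin M) : ℝ :=
  (M : ℝ)⁻¹ * ∑ m, ∑ y ∈ Finset.univ.filter (fun y : Fin N → Y => φ y ≠ m),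
      ∏ n, W (f m y n) (y n)

/-- The (conditional information) dispersion `V(Q, W)`. -/
noncomputable def Vdisp (W : X → Y → ℝ) (Q : X → ℝ) : ℝ :=
  ∑ x, ∑ y, Q x * W x y *
    (Real.log (W x y / ∑ z, Q z * W z y) -
      ∑ b, W x b * Real.log (W x b / ∑ z, Q z * W z b)) ^ 2

/-- The `ε`-dispersion `V_ε(W)`: the minimum (for `ε < 1/2`) or maximum (for `ε ≥ 1/2`) of
`V(Q,W)` over capacity-achieving input distributions `Q`. -/
noncomputable def Veps (W : X → Y → ℝ) (ε : ℝ) : ℝ :=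
  if ε < 1 / 2 then
    sInf {v | ∃ Q, IsProbDist Q ∧ mutualInfo W Q = capacity W ∧ v = Vdisp W Q}
  else
    sSup {v | ∃ Q, IsProbDist Q ∧ mutualInfo W Q = capacity W ∧ v = Vdisp W Q}

/-- The standard Gaussian cumulative distribution function `Φ`. -/
noncomputable def stdGaussCDF (x : ℝ) : ℝ :=
  (Real.sqrt (2 * Real.pi))⁻¹ * ∫ t in Set.Iic x, Real.exp (-t ^ 2 / 2)

/-- The inverse `Φ⁻¹` of the standard Gaussian CDF. -/
noncomputable def stdGaussInvCDF (p : ℝ) : ℝ := sInf {x | p ≤ stdGaussCDF x}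

/-- The output distribution induced by the input distribution `Q`. -/
noncomputable def outDist (W : X → Y → ℝ) (Q : X → ℝ) (y : Y) : ℝ := ∑ z, Q z * W z y

/-- The divergence between the row of `x` and the output distribution induced by `Q`. -/
noncomputable def rowDiv (W : X → Y → ℝ) (Q : X → ℝ) (x : X) : ℝ :=
  ∑ b, W x b * Real.log (W x b / outDist W Q b)

lemma sum_prod_eq_prod_sum {N : ℕ} (p : Fin N → Y → ℝ) :
    ∑ y : Fin N → Y, ∏ n, p n (y n) = ∏ n, ∑ b, p n b := by
  rw [Finset.prod_univ_sum, Fintype.piFinset_univ]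

lemma sum_prod_mul_mul_eq_zero {N : ℕ} (p g : Fin N → Y → ℝ)
    (hg : ∀ n, ∑ b, p n b * g n b = 0) {i j : Fin N} (hij : i ≠ j) :
    ∑ y : Fin N → Y, (∏ n, p n (y n)) * (g i (y i) * g j (y j)) = 0 := by
  have key : ∀ y : Fin N → Y, (∏ n, p n (y n)) * (g i (y i) * g j (y j)) =
      ∏ n, p n (y n) * ((if n = i then g n (y n) else 1) * if n = j then g n (y n) else 1) := by
    intro y
    rw [Finset.prod_mul_distrib, Finset.prod_mul_distrib]
    simp
  simp_rw [key]
  rw [sum_prod_eq_prod_sum fun n b =>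
    p n b * ((if n = i then g n b else 1) * if n = j then g n b else 1)]
  apply Finset.prod_eq_zero (Finset.mem_univ i)
  simpa [hij] using hg i

lemma sum_prod_mul_eq {N : ℕ} (p : Fin N → Y → ℝ) (hp : ∀ n, ∑ b, p n b = 1)
    (i : Fin N) (h : Y → ℝ) :
    ∑ y : Fin N → Y, (∏ n, p n (y n)) * h (y i) = ∑ b, p i b * h b := by
  have key : ∀ y : Fin N → Y, (∏ n, p n (y n)) * h (y i) =
      ∏ n, p n (y n) * (if n = i then h (y n) else 1) := by
    intro y
    rw [Finset.prod_mul_distrib]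
    simp
  simp_rw [key]
  rw [sum_prod_eq_prod_sum fun n b => p n b * (if n = i then h b else 1)]
  rw [Finset.prod_eq_single i]
  · simp
  · intro n _ hn
    simpa [hn] using hp n
  · simp

/-- Second moment of a sum of independent centred terms. -/
lemma sum_prod_mul_sum_sq {N : ℕ} (p g : Fin N → Y → ℝ) (hp : ∀ n, ∑ b, p n b = 1)
    (hg : ∀ n, ∑ b, p n b * g n b = 0) :
    ∑ y : Fin N → Y, (∏ n, p n (y n)) * (∑ n, g n (y n)) ^ 2 =
      ∑ n, ∑ b, p n b * g n b ^ 2 := by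
  simp_rw [sq, Finset.sum_mul_sum, Finset.mul_sum]
  rw [Finset.sum_comm]
  refine Finset.sum_congr rfl fun i _ => ?_
  rw [Finset.sum_comm, Finset.sum_eq_single i]
  · exact sum_prod_mul_eq p hp i fun b => g i b * g i b
  · intro j _ hj
    exact sum_prod_mul_mul_eq_zero p g hg hj.symm
  · simp

lemma outDist_nonneg {W : X → Y → ℝ} {Q : X → ℝ} (hW : IsDMC W) (hQ : IsProbDist Q) (y : Y) :
    0 ≤ outDist W Q y :=
  Finset.sum_nonneg fun z _ => mul_nonneg (hQ.1 z) (hW.1 z y)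

lemma mul_le_outDist {W : X → Y → ℝ} {Q : X → ℝ} (hW : IsDMC W) (hQ : IsProbDist Q)
    (x : X) (y : Y) : Q x * W x y ≤ outDist W Q y :=
  Finset.single_le_sum (f := fun z => Q z * W z y)
    (fun z _ => mul_nonneg (hQ.1 z) (hW.1 z y)) (Finset.mem_univ x)

lemma sum_outDist {W : X → Y → ℝ} {Q : X → ℝ} (hW : IsDMC W) (hQ : IsProbDist Q) :
    ∑ y, outDist W Q y = 1 := by
  unfold outDist
  rw [Finset.sum_comm]
  simp_rw [← Finset.mul_sum, hW.2, mul_one]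
  exact hQ.2

lemma IsProbDist.le_one {Q : X → ℝ} (hQ : IsProbDist Q) (x : X) : Q x ≤ 1 :=
  hQ.2 ▸ Finset.single_le_sum (fun z _ => hQ.1 z) (Finset.mem_univ x)

lemma IsDMC.le_one {X : Type} {W : X → Y → ℝ} (hW : IsDMC W) (x : X) (y : Y) : W x y ≤ 1 :=
  hW.2 x ▸ Finset.single_le_sum (fun z _ => hW.1 x z) (Finset.mem_univ y)

lemma outDist_le_one {W : X → Y → ℝ} {Q : X → ℝ} (hW : IsDMC W) (hQ : IsProbDist Q) (y : Y) :
    outDist W Q y ≤ 1 :=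
  sum_outDist hW hQ ▸ Finset.single_le_sum (fun z _ => outDist_nonneg hW hQ z) (Finset.mem_univ y)

lemma mutualInfo_eq_sum_rowDiv (W : X → Y → ℝ) (Q : X → ℝ) :
    mutualInfo W Q = ∑ x, Q x * rowDiv W Q x := by
  simp [mutualInfo, rowDiv, outDist, Finset.mul_sum, mul_assoc]

lemma mutualInfo_eq_entropy_sub {W : X → Y → ℝ} {Q : X → ℝ} (hW : IsDMC W)
    (hQ : IsProbDist Q) :
    mutualInfo W Q = (∑ x, ∑ y, Q x * W x y * Real.log (W x y)) +
      ∑ y, Real.negMulLog (∑ x, Q x * W x y) := by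
  simp_rw [Real.negMulLog, ← Finset.sum_neg_distrib, Finset.sum_mul]
  rw [Finset.sum_comm (f := fun y x => -(Q x * W x y) * Real.log (∑ x, Q x * W x y)),
    mutualInfo, ← Finset.sum_add_distrib]
  refine Finset.sum_congr rfl fun x _ => ?_
  rw [← Finset.sum_add_distrib]
  refine Finset.sum_congr rfl fun y _ => ?_
  rcases (mul_nonneg (hQ.1 x) (hW.1 x y)).eq_or_lt with h | h
  · simp [← h]
  · have h2 := mul_le_outDist hW hQ x y
    rw [outDist] at h2
    rw [Real.log_div (right_ne_zero_of_mul h.ne') (h.trans_le h2).ne']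
    ring

lemma continuousOn_mutualInfo {W : X → Y → ℝ} (hW : IsDMC W) :
    ContinuousOn (mutualInfo W) {Q | IsProbDist Q} := by
  have : Continuous fun Q : X → ℝ => (∑ x, ∑ y, Q x * W x y * Real.log (W x y)) +
      ∑ y, Real.negMulLog (∑ x, Q x * W x y) := by
    have := Real.continuous_negMulLog
    fun_prop
  exact this.continuousOn.congr fun Q hQ => mutualInfo_eq_entropy_sub hW hQ

lemma isCompact_isProbDist : IsCompact {Q : X → ℝ | IsProbDist Q} :=
  isCompact_stdSimplex ℝ X

lemma mutualInfo_le_capacity {W : X → Y → ℝ} (hW : IsDMC W) {Q : X → ℝ} (hQ : IsProbDist Q) :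
    mutualInfo W Q ≤ capacity W := by
  apply le_csSup
  · have h := (isCompact_isProbDist (X := X)).bddAbove_image (continuousOn_mutualInfo hW)
    convert h using 1
    ext r
    simp [eq_comm]
  · exact ⟨Q, hQ, rfl⟩

/-- Away from the capacity-achieving input distributions, the mutual information is bounded
away from the capacity. -/
lemma exists_capacity_gap {W : X → Y → ℝ} (hW : IsDMC W) {δ : ℝ} (hδ : 0 < δ) :
    ∃ η > 0, ∀ Q : X → ℝ, IsProbDist Q →
      (∀ P : X → ℝ, IsProbDist P → mutualInfo W P = capacity W →
          δ < Real.sqrt (∑ x, (Q x - P x) ^ 2)) → mutualInfo W Q ≤ capacity W - η := by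
  set T : Set (X → ℝ) := {Q | ∀ P : X → ℝ, IsProbDist P → mutualInfo W P = capacity W →
          δ ≤ Real.sqrt (∑ x, (Q x - P x) ^ 2)} with hT
  have hTc : IsClosed T := by
    simp only [hT, Set.ofPred_forall]
    refine isClosed_iInter fun P => isClosed_iInter fun _ => isClosed_iInter fun _ => ?_
    exact isClosed_le continuous_const (by fun_prop)
  have hK : IsCompact ({Q : X → ℝ | IsProbDist Q} ∩ T) := isCompact_isProbDist.inter_right hTc
  rcases ({Q : X → ℝ | IsProbDist Q} ∩ T).eq_empty_or_nonempty with he | hne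
  · refine ⟨1, one_pos, fun Q hQ hQT => ?_⟩
    have : Q ∈ {Q : X → ℝ | IsProbDist Q} ∩ T := ⟨hQ, fun P hP hPc => (hQT P hP hPc).le⟩
    simp [he] at this
  · obtain ⟨Q₀, hQ₀, hmax⟩ := hK.exists_isMaxOn hne
      ((continuousOn_mutualInfo hW).mono Set.inter_subset_left)
    refine ⟨capacity W - mutualInfo W Q₀, ?_, fun Q hQ hQT => ?_⟩
    · refine sub_pos.2 (lt_of_le_of_ne (mutualInfo_le_capacity hW hQ₀.1) fun h => ?_)
      have := hQ₀.2 Q₀ hQ₀.1 h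
      simp at this
      linarith
    · have : mutualInfo W Q ≤ mutualInfo W Q₀ :=
        hmax ⟨hQ, fun P hP hPc => (hQT P hP hPc).le⟩
      linarith

lemma mul_log_sq_le {t : ℝ} (h0 : 0 < t) (h1 : t ≤ 1) : t * Real.log t ^ 2 ≤ 4 := by
  have hs := Real.sqrt_pos.2 h0
  have h := Real.abs_log_mul_self_lt (√t) hs (Real.sqrt_le_one.2 h1)
  rw [Real.log_sqrt h0.le] at h
  have h2 : (Real.log t / 2 * √t) ^ 2 ≤ 1 := by
    rw [← sq_abs]
    exact pow_le_one₀ (abs_nonneg _) h.le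
  rw [mul_pow, Real.sq_sqrt h0.le] at h2
  linarith

lemma mul_mul_log_div_sq_le {W : X → Y → ℝ} {Q : X → ℝ} (hW : IsDMC W) (hQ : IsProbDist Q)
    (x : X) (y : Y) : Q x * W x y * Real.log (W x y / outDist W Q y) ^ 2 ≤ 8 := by
  rcases (mul_nonneg (hQ.1 x) (hW.1 x y)).eq_or_lt with h | h
  · simp [← h]
  have hw : 0 < W x y := (hW.1 x y).lt_of_ne' (right_ne_zero_of_mul h.ne')
  have hq : 0 < Q x := (hQ.1 x).lt_of_ne' (left_ne_zero_of_mul h.ne')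
  have hle := mul_le_outDist hW hQ x y
  have ho : 0 < outDist W Q y := h.trans_le hle
  have hw1 := hW.le_one x y
  have hq1 := hQ.le_one x
  have hlog : Real.log (W x y / outDist W Q y) ^ 2 ≤ Real.log (W x y) ^ 2 + Real.log (Q x) ^ 2 := by
    have l1 : Real.log (Q x) + Real.log (W x y) ≤ Real.log (outDist W Q y) := by
      rw [← Real.log_mul hq.ne' hw.ne']
      exact Real.log_le_log h hle
    have l2 : Real.log (outDist W Q y) ≤ 0 :=
      Real.log_nonpos ho.le (outDist_le_one hW hQ y)
    have l3 : Real.log (W x y) ≤ 0 := Real.log_nonpos hw.le hw1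
    have l4 : Real.log (Q x) ≤ 0 := Real.log_nonpos hq.le hq1
    rw [Real.log_div hw.ne' ho.ne']
    rcases le_total (Real.log (W x y) - Real.log (outDist W Q y)) 0 with hs | hs <;> nlinarith
  have b1 := mul_log_sq_le hw hw1
  have b2 := mul_log_sq_le hq hq1
  calc Q x * W x y * Real.log (W x y / outDist W Q y) ^ 2
      ≤ Q x * W x y * (Real.log (W x y) ^ 2 + Real.log (Q x) ^ 2) := by gcongr
    _ = Q x * (W x y * Real.log (W x y) ^ 2) + W x y * (Q x * Real.log (Q x) ^ 2) := by ring
    _ ≤ 1 * 4 + 1 * 4 := by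
        gcongr
    _ = 8 := by norm_num

/-- The dispersion is bounded uniformly in the input distribution. -/
lemma sum_mul_centred_sq_le {W : X → Y → ℝ} {Q : X → ℝ} (hW : IsDMC W) (hQ : IsProbDist Q) :
    ∑ x, Q x * ∑ y, W x y * (Real.log (W x y / outDist W Q y) - rowDiv W Q x) ^ 2 ≤
      8 * Fintype.card X * Fintype.card Y := by
  calc _ ≤ ∑ x, Q x * ∑ y, W x y * Real.log (W x y / outDist W Q y) ^ 2 := by
        refine Finset.sum_le_sum fun x _ => mul_le_mul_of_nonneg_left ?_ (hQ.1 x)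
        have : ∑ y, W x y * (Real.log (W x y / outDist W Q y) - rowDiv W Q x) ^ 2 =
            (∑ y, W x y * Real.log (W x y / outDist W Q y) ^ 2) - rowDiv W Q x ^ 2 := by
          calc _ = ∑ y, (W x y * Real.log (W x y / outDist W Q y) ^ 2
                - 2 * rowDiv W Q x * (W x y * Real.log (W x y / outDist W Q y))
                + rowDiv W Q x ^ 2 * W x y) := Finset.sum_congr rfl fun y _ => by ring
            _ = _ := by
              rw [Finset.sum_add_distrib, Finset.sum_sub_distrib, ← Finset.mul_sum,
                ← Finset.mul_sum, hW.2, ← rowDiv]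
              ring
        rw [this]
        linarith [sq_nonneg (rowDiv W Q x)]
    _ = ∑ x, ∑ y, Q x * W x y * Real.log (W x y / outDist W Q y) ^ 2 := by
        simp_rw [Finset.mul_sum, mul_assoc]
    _ ≤ ∑ _x : X, ∑ _y : Y, (8 : ℝ) := by
        gcongr with x _ y
        exact mul_mul_log_div_sq_le hW hQ x y
    _ = 8 * Fintype.card X * Fintype.card Y := by
        simp
        ring

lemma sum_comp_eq_of_composition [DecidableEq X] {N : ℕ} {Q : X → ℝ} {c : Fin N → X}
    (hc : ∀ x, ((Finset.univ.filter fun n => c n = x).card : ℝ) = N * Q x) (h : X → ℝ) :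
    ∑ n, h (c n) = N * ∑ x, Q x * h x := by
  rw [← Finset.sum_fiberwise Finset.univ c, Finset.mul_sum]
  refine Finset.sum_congr rfl fun x _ => ?_
  rw [Finset.sum_congr rfl (g := fun _ => h x) (by simp +contextual), Finset.sum_const,
    nsmul_eq_mul, hc, mul_assoc]

/-- Either the information density is small, and a change of measure applies, or it deviates
from its mean, and Chebyshev's weight is at least one. -/
lemma prod_le_chebyshev_add_exp_mul [DecidableEq X] {W : X → Y → ℝ} {Q : X → ℝ} (hW : IsDMC W)
    (hQ : IsProbDist Q) {N : ℕ} {c : Fin N → X}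
    (hc : ∀ x, ((Finset.univ.filter fun n => c n = x).card : ℝ) = N * Q x)
    {a : ℝ} (ha : 0 < a) (y : Fin N → Y) :
    ∏ n, W (c n) (y n) ≤
      (∏ n, W (c n) (y n)) *
        (∑ n, (Real.log (W (c n) (y n) / outDist W Q (y n)) - rowDiv W Q (c n))) ^ 2 / a ^ 2 +
      Real.exp (N * mutualInfo W Q + a) * ∏ n, outDist W Q (y n) := by
  have hq0 : 0 ≤ ∏ n, outDist W Q (y n) := Finset.prod_nonneg fun n _ => outDist_nonneg hW hQ _
  rcases (Finset.prod_nonneg fun n _ => hW.1 (c n) (y n) :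
    0 ≤ ∏ n, W (c n) (y n)).eq_or_lt with h | h
  · rw [← h]
    simp only [zero_mul, zero_div, zero_add]
    positivity
  have hw : ∀ n, 0 < W (c n) (y n) := fun n =>
    (hW.1 _ _).lt_of_ne' (Finset.prod_ne_zero_iff.1 h.ne' n (Finset.mem_univ n))
  have hQc : ∀ n, 0 < Q (c n) := fun n => by
    refine (hQ.1 _).lt_of_ne' fun h0 => ?_
    have := hc (c n)
    rw [h0, mul_zero, Nat.cast_eq_zero, Finset.card_eq_zero] at this
    exact Finset.notMem_empty n (this ▸ by simp)
  have ho : ∀ n, 0 < outDist W Q (y n) := fun n =>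
    (mul_pos (hQc n) (hw n)).trans_le (mul_le_outDist hW hQ _ _)
  have hmean : ∑ n, rowDiv W Q (c n) = N * mutualInfo W Q := by
    rw [sum_comp_eq_of_composition hc, mutualInfo_eq_sum_rowDiv]
  rw [Finset.sum_sub_distrib, hmean]
  set S := ∑ n, Real.log (W (c n) (y n) / outDist W Q (y n)) with hS
  have hexp : ∏ n, W (c n) (y n) = Real.exp S * ∏ n, outDist W Q (y n) := by
    rw [hS, Real.exp_sum, ← Finset.prod_mul_distrib]
    refine Finset.prod_congr rfl fun n _ => ?_
    rw [Real.exp_log (div_pos (hw n) (ho n)), div_mul_cancel₀ _ (ho n).ne']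
  rcases le_or_gt S (N * mutualInfo W Q + a) with hs | hs
  · have h1 : Real.exp S * ∏ n, outDist W Q (y n) ≤
        Real.exp (N * mutualInfo W Q + a) * ∏ n, outDist W Q (y n) := by gcongr
    have h2 : 0 ≤ (∏ n, W (c n) (y n)) * (S - N * mutualInfo W Q) ^ 2 / a ^ 2 := by positivity
    linarith
  · have h1 : 1 ≤ (S - N * mutualInfo W Q) ^ 2 / a ^ 2 := by
      rw [one_le_div (by positivity)]
      gcongr
      linarith
    have h2 := mul_le_mul_of_nonneg_left h1 h.le
    rw [mul_one, ← mul_div_assoc] at h2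
    have h3 : 0 ≤ Real.exp (N * mutualInfo W Q + a) * ∏ n, outDist W Q (y n) := by positivity
    linarith

/-- A non-asymptotic converse for constant composition codes. -/
lemma one_sub_le_avgErrorProb [DecidableEq X] {W : X → Y → ℝ} {Q : X → ℝ} (hW : IsDMC W)
    (hQ : IsProbDist Q) {N M : ℕ} (hM : 0 < M) (f : Fin M → Fin N → X)
    (φ : (Fin N → Y) → Fin M)
    (hf : ∀ m x, ((Finset.univ.filter fun n => f m n = x).card : ℝ) = N * Q x)
    {a : ℝ} (ha : 0 < a) :
    1 - (N * (8 * Fintype.card X * Fintype.card Y) / a ^ 2 +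
      Real.exp (N * mutualInfo W Q + a) / M) ≤ avgErrorProb W f φ := by
  set B : ℝ := 8 * Fintype.card X * Fintype.card Y
  have hM' : (0 : ℝ) < M := Nat.cast_pos.2 hM
  set G := Real.exp (N * mutualInfo W Q + a)
  have hmsg : ∀ m, 1 - (N * B / a ^ 2 +
      G * ∑ y ∈ Finset.univ.filter (fun y => φ y = m), ∏ n, outDist W Q (y n)) ≤
      msgErrorProb W f φ m := by
    intro m
    have htot : ∑ y : Fin N → Y, ∏ n, W (f m n) (y n) = 1 := by
      rw [sum_prod_eq_prod_sum fun n b => W (f m n) b]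
      simp [hW.2]
    rw [← Finset.sum_filter_add_sum_filter_not Finset.univ (fun y => φ y = m)] at htot
    have hcorr : ∑ y ∈ Finset.univ.filter (fun y => φ y = m), ∏ n, W (f m n) (y n) ≤
        N * B / a ^ 2 +
        G * ∑ y ∈ Finset.univ.filter (fun y => φ y = m), ∏ n, outDist W Q (y n) := by
      refine (Finset.sum_le_sum fun y _ =>
        prod_le_chebyshev_add_exp_mul hW hQ (hf m) ha y).trans ?_
      rw [Finset.sum_add_distrib, ← Finset.mul_sum, ← Finset.sum_div]
      gcongr
      calc _ ≤ ∑ y : Fin N → Y, (∏ n, W (f m n) (y n)) * (∑ n,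
            (Real.log (W (f m n) (y n) / outDist W Q (y n)) - rowDiv W Q (f m n))) ^ 2 :=
            Finset.sum_le_sum_of_subset_of_nonneg (Finset.filter_subset _ _) fun y _ _ =>
              mul_nonneg (Finset.prod_nonneg fun n _ => hW.1 _ _) (sq_nonneg _)
        _ = ∑ n, ∑ b, W (f m n) b *
              (Real.log (W (f m n) b / outDist W Q b) - rowDiv W Q (f m n)) ^ 2 := by
            refine sum_prod_mul_sum_sq (fun n b => W (f m n) b)
              (fun n b => Real.log (W (f m n) b / outDist W Q b) - rowDiv W Q (f m n))
              (fun n => hW.2 _) fun n => ?_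
            simp_rw [mul_sub]
            rw [Finset.sum_sub_distrib, ← Finset.sum_mul, hW.2, one_mul, rowDiv, sub_self]
        _ = N * ∑ x, Q x * ∑ b, W x b *
              (Real.log (W x b / outDist W Q b) - rowDiv W Q x) ^ 2 :=
            sum_comp_eq_of_composition (hf m) fun x => ∑ b, W x b *
              (Real.log (W x b / outDist W Q b) - rowDiv W Q x) ^ 2
        _ ≤ N * B := by
            gcongr
            exact sum_mul_centred_sq_le hW hQ
    have hdef : msgErrorProb W f φ m =
        ∑ y ∈ Finset.univ.filter (fun y => ¬ φ y = m), ∏ n, W (f m n) (y n) := rfl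
    linarith
  have htotal : ∑ m, ∑ y ∈ Finset.univ.filter (fun y => φ y = m), ∏ n, outDist W Q (y n) = 1 := by
    rw [Finset.sum_fiberwise Finset.univ φ, sum_prod_eq_prod_sum fun _ b => outDist W Q b]
    simp [sum_outDist hW hQ]
  have hsum := Finset.sum_le_sum fun m (_ : m ∈ Finset.univ) => hmsg m
  rw [Finset.sum_sub_distrib, Finset.sum_add_distrib, ← Finset.mul_sum, htotal] at hsum
  simp only [Finset.sum_const, Finset.card_univ, Fintype.card_fin, nsmul_eq_mul] at hsum
  rw [avgErrorProb, ← div_eq_inv_mul, le_div_iff₀ hM']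
  refine le_trans (le_of_eq ?_) hsum
  field_simp

/-- **Lemma (asym-lem1)**: if `C(W) > 0`, `δ > 0`, `ε ∈ (0,1)` and
`R_N = C(W) + √(V_ε(W)/N)·Φ⁻¹(ε)`, then there is `N₀` such that for all `N ≥ N₀`, every
constant composition `(N, R_N)` code whose common composition `Q_N` is at `ℓ²`-distance more
than `δ` from every capacity-achieving input distribution has average error probability
exceeding `ε`. -/
theorem statement18 {X Y : Type} [Fintype X] [Fintype Y] [DecidableEq X]
    [Nonempty X] [Nonempty Y]
    (W : X → Y → ℝ) (hW : IsDMC W) (hC : 0 < capacity W)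
    (δ : ℝ) (hδ : 0 < δ) (ε : ℝ) (hε0 : 0 < ε) (hε1 : ε < 1) :
    ∃ N₀ : ℕ, 0 < N₀ ∧ ∀ N : ℕ, N₀ ≤ N →
      ∀ Q : X → ℝ, IsProbDist Q →
        (∀ P : X → ℝ, IsProbDist P → mutualInfo W P = capacity W →
          δ < Real.sqrt (∑ x, (Q x - P x) ^ 2)) →
        ∀ (f : Fin (Mof N (capacity W + Real.sqrt (Veps W ε / N) * stdGaussInvCDF ε)) →
              Fin N → X)
          (φ : (Fin N → Y) →
              Fin (Mof N (capacity W + Real.sqrt (Veps W ε / N) * stdGaussInvCDF ε))),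
          (∀ m x, ((Finset.univ.filter fun n => f m n = x).card : ℝ) = N * Q x) →
          ε < avgErrorProb W f φ := by
  obtain ⟨η, hη, hgap⟩ := exists_capacity_gap hW hδ
  set κ : ℝ := Real.sqrt (Veps W ε) * |stdGaussInvCDF ε| with hκ
  set B : ℝ := 8 * Fintype.card X * Fintype.card Y with hB
  have hlim1 : Filter.Tendsto (fun N : ℕ => (B / (η / 2) ^ 2) / (N : ℝ)) Filter.atTop (nhds 0) :=
    tendsto_const_div_atTop_nhds_zero_nat _
  have hsqrt : Filter.Tendsto (fun N : ℕ => Real.sqrt N) Filter.atTop Filter.atTop :=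
    Real.tendsto_sqrt_atTop.comp tendsto_natCast_atTop_atTop
  have hlim2 : Filter.Tendsto (fun N : ℕ => Real.exp (-(Real.sqrt N * (η / 2 * Real.sqrt N - κ))))
      Filter.atTop (nhds 0) := by
    refine Real.tendsto_exp_neg_atTop_nhds_zero.comp (hsqrt.atTop_mul_atTop₀ ?_)
    exact Filter.tendsto_atTop_add_const_right _ (-κ) (hsqrt.const_mul_atTop (half_pos hη))
  have hlim := hlim1.add hlim2
  rw [add_zero] at hlim
  obtain ⟨N₁, hN₁⟩ := Filter.eventually_atTop.1 (hlim.eventually_lt_const (sub_pos.2 hε1))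
  refine ⟨N₁ + 1, Nat.succ_pos _, fun N hN Q hQ hQT => ?_⟩
  have hbound := hN₁ N (by omega)
  have hN0 : (0 : ℝ) < N := Nat.cast_pos.2 (by omega)
  have hI := hgap Q hQ hQT
  have hs0 : 0 < Real.sqrt N := Real.sqrt_pos.2 hN0
  have hss : Real.sqrt N * Real.sqrt N = N := Real.mul_self_sqrt hN0.le
  generalize hR : capacity W + Real.sqrt (Veps W ε / N) * stdGaussInvCDF ε = R
  intro f φ hf
  have hMle : Real.exp (N * R) ≤ (Mof N R : ℝ) := Nat.le_ceil _
  have hMpos : 0 < Mof N R := Nat.ceil_pos.2 (Real.exp_pos _)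
  have hNR : N * capacity W - κ * Real.sqrt N ≤ N * R := by
    have h1 : (N : ℝ) * Real.sqrt (Veps W ε / N) = Real.sqrt N * Real.sqrt (Veps W ε) := by
      rw [Real.sqrt_div' _ hN0.le]
      field_simp
      rw [sq, hss, mul_comm]
    have h2 : (N : ℝ) * R = N * capacity W +
        Real.sqrt N * Real.sqrt (Veps W ε) * stdGaussInvCDF ε := by
      rw [← hR, mul_add, ← mul_assoc, h1]
    have h3 := mul_le_mul_of_nonneg_left (neg_abs_le (stdGaussInvCDF ε))
      (mul_nonneg hs0.le (Real.sqrt_nonneg (Veps W ε)))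
    rw [h2, hκ]
    linarith
  have hmain := one_sub_le_avgErrorProb hW hQ hMpos f φ hf (a := N * (η / 2)) (by positivity)
  have hfirst : N * B / (N * (η / 2)) ^ 2 = (B / (η / 2) ^ 2) / (N : ℝ) := by
    field_simp
  have hsecond : Real.exp (N * mutualInfo W Q + N * (η / 2)) / (Mof N R : ℝ) ≤
      Real.exp (-(Real.sqrt N * (η / 2 * Real.sqrt N - κ))) := by
    calc _ ≤ Real.exp (N * mutualInfo W Q + N * (η / 2)) / Real.exp (N * R) := by gcongr
      _ = Real.exp (N * mutualInfo W Q + N * (η / 2) - N * R) := (Real.exp_sub _ _).symm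
      _ ≤ _ := by
        apply Real.exp_le_exp.2
        have h4 : Real.sqrt N * (η / 2 * Real.sqrt N - κ) = N * (η / 2) - κ * Real.sqrt N := by
          linear_combination (η / 2) * hss
        have h5 := mul_le_mul_of_nonneg_left hI hN0.le
        linarith
  rw [← hB, hfirst] at hmain
  linarith
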